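/- Let R be a commutative noetherian ring and a ⊊ R a proper ideal. If every localization R_p is Gorenstein and (R, m, k) is local, then every m-adically semidualizing R-module T satisfies T ≅ E_R(k). -/

import Mathlib

open CategoryTheory

noncomputable section
universe u

/-- `Ext^i_R(M, N)`. -/
abbrev extMod (R : Type u) [CommRing R] (i : ℕ) (M N : Type u) [AddCommGroup M] [Module R M]
    [AddCommGroup N] [Module R N] : ModuleCat R :=
  ((Ext R (ModuleCat.{u} R) i).obj (Opposite.op (ModuleCat.of R M))).obj (ModuleCat.of R N)

/-- A noetherian local ring `A` is Gorenstein if `Ext^i_A(k, A)` vanishes for `i ≠ d` and is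
isomorphic to the residue field `k` for `i = d` (for some `d`). -/
def IsGorensteinLocalRing (A : Type u) [CommRing A] [IsLocalRing A] : Prop :=
  ∃ d : ℕ,
    (∀ i : ℕ, i ≠ d → Subsingleton (extMod A i (IsLocalRing.ResidueField A) A)) ∧
    Nonempty (extMod A d (IsLocalRing.ResidueField A) A ≃ₗ[A] IsLocalRing.ResidueField A)

/-- `M` is `a`-torsion: every element is annihilated by a power of `a`. -/
def IsAdicTorsion (R : Type u) [CommRing R] (a : Ideal R) (M : Type u)
    [AddCommGroup M] [Module R M] : Prop :=
  ∀ x : M, ∃ n : ℕ, ∀ r ∈ a ^ n, r • x = 0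

/-- `M` is `a`-adically semidualizing over `R`. -/
def IsAdicSemidualizing (R : Type u) [CommRing R] (a : Ideal R) (M : Type u)
    [AddCommGroup M] [Module R M] : Prop :=
  IsAdicTorsion R a M ∧
  (∀ i : ℕ, Module.Finite R (extMod R i (R ⧸ a) M)) ∧
  (∃ χ : AdicCompletion a R →ₐ[R] Module.End R M, Function.Bijective χ) ∧
  ∀ i : ℕ, 1 ≤ i → Subsingleton (extMod R i M M)

/-- `E` is an injective hull of the residue field `k` of a local ring `R`. -/
def IsInjectiveHullOfResidueField (R : Type u) [CommRing R] [IsLocalRing R]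
    (E : Type u) [AddCommGroup E] [Module R E] : Prop :=
  Module.Injective R E ∧
  ∃ f : IsLocalRing.ResidueField R →ₗ[R] E, Function.Injective f ∧
    ∀ N : Submodule R E, N ≠ ⊥ → N ⊓ LinearMap.range f ≠ ⊥

lemma ext_desc {A : Type u} [CommRing A] {X : ModuleCat.{u} A} (P : ProjectiveResolution X)
    (Y : ModuleCat.{u} A) (i : ℕ) :
    ∃ φ : LinearMap.ker (LinearMap.lcomp A Y (P.complex.d (i+1) i).hom) →ₗ[A]
        ((Ext A (ModuleCat.{u} A) i).obj (Opposite.op X)).obj Y,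
      Function.Surjective φ ∧
      ∀ z, φ z = 0 ↔ ∃ g : P.complex.X (i-1) →ₗ[A] Y, z.1 = g ∘ₗ (P.complex.d i (i-1)).hom := by
  let K := P.complex.linearYonedaObj A Y
  let S := K.sc' (i-1) i (i+1)
  let e1 := P.isoExt (R := A) i Y
  let e2 := ShortComplex.homologyMapIso (K.isoSc' (i-1) i (i+1) (by cases i <;> simp) (by simp))
  let e := (e1 ≪≫ e2 ≪≫ S.moduleCatHomologyIso).toLinearEquiv
  let ι : LinearMap.ker (LinearMap.lcomp A Y (P.complex.d (i+1) i).hom) →ₗ[A]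
      LinearMap.ker S.g.hom :=
    { toFun := fun f => ⟨ModuleCat.ofHom f.1, by
        have h := f.2
        rw [LinearMap.mem_ker] at h
        change P.complex.d (i+1) i ≫ ModuleCat.ofHom f.1 = 0
        ext x
        exact LinearMap.congr_fun h x⟩
      map_add' := fun _ _ => rfl
      map_smul' := fun _ _ => rfl }
  have hι : Function.Surjective ι := by
    rintro ⟨g, hg⟩
    have hg' : P.complex.d (i+1) i ≫ (show P.complex.X i ⟶ Y from g) = 0 := hg
    refine ⟨⟨ModuleCat.Hom.hom (show P.complex.X i ⟶ Y from g), ?_⟩, rfl⟩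
    rw [LinearMap.mem_ker]
    ext x
    exact LinearMap.congr_fun (congrArg ModuleCat.Hom.hom hg') x
  let π : LinearMap.ker S.g.hom →ₗ[A] S.moduleCatLeftHomologyData.H :=
    S.moduleCatLeftHomologyData.π.hom
  have hπ : Function.Surjective π := Submodule.mkQ_surjective _
  have hπ0 : ∀ z, π z = 0 ↔ z ∈ LinearMap.range S.moduleCatToCycles := fun z => 
    Submodule.Quotient.mk_eq_zero _
  refine ⟨e.symm.toLinearMap ∘ₗ π ∘ₗ ι, ?_, ?_⟩
  · exact e.symm.surjective.comp (hπ.comp hι)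
  · intro z
    rw [LinearMap.comp_apply, LinearEquiv.coe_coe, LinearEquiv.map_eq_zero_iff,
      LinearMap.comp_apply, hπ0]
    constructor
    · rintro ⟨g, hg⟩
      refine ⟨ModuleCat.Hom.hom (show P.complex.X (i-1) ⟶ Y from g), ?_⟩
      have := congrArg Subtype.val hg
      exact (congrArg ModuleCat.Hom.hom (show P.complex.d i (i-1) ≫ (show P.complex.X (i-1) ⟶ Y from g) = ModuleCat.ofHom z.1 from this)).symm
    · rintro ⟨g, hg⟩
      refine ⟨ModuleCat.ofHom g, Subtype.ext ?_⟩
      change P.complex.d i (i-1) ≫ ModuleCat.ofHom g = ModuleCat.ofHom z.1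
      rw [hg]; rfl

/-- `Ext` vanishing, old to new -/
lemma ext_new {A : Type u} [CommRing A] {X : ModuleCat.{u} A} 
    (Y : ModuleCat.{u} A) (i : ℕ) (h : Subsingleton (((Ext A (ModuleCat.{u} A) (i+1)).obj (Opposite.op X)).obj Y)) :
    Subsingleton (Abelian.Ext X Y (i+1)) := by
  let P := projectiveResolution X
  obtain ⟨φ, -, hφ⟩ := ext_desc P Y (i+1)
  refine subsingleton_of_forall_eq 0 fun α => ?_
  obtain ⟨f, hf, rfl⟩ := P.extMk_surjective α (i+2) rfl
  rw [P.extMk_eq_zero_iff _ _ _ _ i rfl]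
  obtain ⟨g, hg⟩ := (hφ ⟨f.hom, by
    rw [LinearMap.mem_ker]; ext x; exact LinearMap.congr_fun (congrArg ModuleCat.Hom.hom hf) x⟩).1 (Subsingleton.elim _ _)
  refine ⟨ModuleCat.ofHom g, ?_⟩
  ext x
  exact (LinearMap.congr_fun hg x).symm


/-- one step of a finite free resolution -/
lemma exists_step {A : Type u} [CommRing A] [IsNoetherianRing A]
    (s : Σ n : ℕ, Submodule A (Fin n → A)) :
    ∃ (m : ℕ) (f : (Fin m → A) →ₗ[A] (Fin s.1 → A)), LinearMap.range f = s.2 := by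
  obtain ⟨m, g, hg⟩ := Module.Finite.exists_fin' A s.2
  refine ⟨m, s.2.subtype ∘ₗ g, ?_⟩
  rw [LinearMap.range_comp, LinearMap.range_eq_top.2 hg, Submodule.map_top, Submodule.range_subtype]

lemma exists_finFree_seq {A : Type u} [CommRing A] [IsNoetherianRing A]
    (K : Submodule A (Fin 1 → A)) :
    ∃ (n : ℕ → ℕ) (h0 : n 0 = 1) (d : ∀ i, (Fin (n (i+1)) → A) →ₗ[A] (Fin (n i) → A)),
      LinearMap.range (d 0) = K.comap (LinearMap.funLeft A A (finCongr h0).symm) ∧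
      ∀ i, Function.Exact (d (i+1)) (d i) := by
  choose m f hf using exists_step (A := A)
  let st : ℕ → Σ n : ℕ, Submodule A (Fin n → A) := fun i =>
    Nat.rec ⟨1, K⟩ (fun _ s => ⟨m s, LinearMap.ker (f s)⟩) i
  refine ⟨fun i => (st i).1, rfl, fun i => f (st i), ?_, fun i => ?_⟩
  · rw [hf]; rfl
  · rw [LinearMap.exact_iff]
    exact (hf (st (i+1))).symm

section
variable {A : Type u} [CommRing A] {n : ℕ → ℕ}
  (d : ∀ i, (Fin (n (i+1)) → A) →ₗ[A] (Fin (n i) → A)) 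
  (hd : ∀ i, Function.Exact (d (i+1)) (d i)) {X : Type u} [AddCommGroup X] [Module A X]
  (ε : (Fin (n 0) → A) →ₗ[A] X) (hε : Function.Surjective ε) (hdε : Function.Exact (d 0) ε)

def resComplex (hd : ∀ i, Function.Exact (d (i+1)) (d i)) : ChainComplex (ModuleCat.{u} A) ℕ :=
  ChainComplex.of (fun i => ModuleCat.of A (Fin (n i) → A)) (fun i => ModuleCat.ofHom (d i))
    (fun i => by
      rw [← ModuleCat.ofHom_comp, (hd i).linearMap_comp_eq_zero]; rfl)

lemma resComplex_d (i : ℕ) : (resComplex d hd).d (i+1) i = ModuleCat.ofHom (d i) :=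
  ChainComplex.of_d (fun i => ModuleCat.of A (Fin (n i) → A)) (fun i => ModuleCat.ofHom (d i)) i

set_option maxHeartbeats 1000000 in
def finRes : ProjectiveResolution (ModuleCat.of A X) where
  complex := resComplex d hd
  projective i := by
    change Projective (ModuleCat.of A (Fin (n i) → A))
    infer_instance
  π := (ChainComplex.toSingle₀Equiv _ _).symm ⟨ModuleCat.ofHom ε, by
          rw [resComplex_d]
          erw [← ModuleCat.ofHom_comp]
          rw [hdε.linearMap_comp_eq_zero]; rfl⟩
  quasiIso := ⟨fun i => by
    cases i
    · rw [ChainComplex.quasiIsoAt₀_iff, ShortComplex.quasiIso_iff_of_zeros']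
      · have : (ShortComplex.mk (ModuleCat.ofHom (d 0)) (ModuleCat.ofHom ε) (by
          rw [← ModuleCat.ofHom_comp, hdε.linearMap_comp_eq_zero]; rfl)).Exact ∧ Epi (ModuleCat.ofHom ε) := 
          ⟨(ShortComplex.ShortExact.moduleCat_exact_iff_function_exact _).2 hdε,
            (ModuleCat.epi_iff_surjective _).2 hε⟩
        refine (ShortComplex.exact_and_epi_g_iff_of_iso ?_).2 this
        exact ShortComplex.isoMk (Iso.refl _) (Iso.refl _) (Iso.refl _)
          (by
            simp only [Iso.refl_hom]
            erw [Category.id_comp]) (by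
            simp only [Iso.refl_hom]
            erw [Category.id_comp])
      all_goals rfl
    · rename_i i
      rw [quasiIsoAt_iff_exactAt']
      · rw [HomologicalComplex.exactAt_iff' _ (i + 1 + 1) (i + 1) i (by simp) (by simp)]
        rw [ShortComplex.ShortExact.moduleCat_exact_iff_function_exact]
        have h1 : (resComplex d hd).d (i+1) i = ModuleCat.ofHom (d i) := resComplex_d d hd i
        have h2 : (resComplex d hd).d (i+1+1) (i+1) = ModuleCat.ofHom (d (i+1)) := resComplex_d d hd (i+1)
        change Function.Exact ((resComplex d hd).d (i+1+1) (i+1)) ((resComplex d hd).d (i+1) i)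
        rw [h1, h2]
        exact hd i
      · apply ChainComplex.exactAt_succ_single_obj⟩
end


/-- Elementary data extracted from the Gorenstein property, for a family of `R`-modules. -/
structure GData (R : Type u) [CommRing R] [IsLocalRing R] (d : ℕ) (D : ℕ → Type u)
    [∀ i, AddCommGroup (D i)] [∀ i, Module R (D i)] (δ : ∀ i, D (i+1) →ₗ[R] D i) : Prop where
  zero : δ 0 = 0
  comp : ∀ i, δ i ∘ₗ δ (i+1) = 0
  ne : ∀ i, i ≠ d → ∀ f : D (i+1) →ₗ[R] R, f ∘ₗ δ (i+1) = 0 → ∃ g : D i →ₗ[R] R, f = g ∘ₗ δ i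
  eq : ∃ z : D (d+1) →ₗ[R] R, z ∘ₗ δ (d+1) = 0 ∧ (¬ ∃ g : D d →ₗ[R] R, z = g ∘ₗ δ d) ∧
    (∀ r ∈ IsLocalRing.maximalIdeal R, ∃ g : D d →ₗ[R] R, r • z = g ∘ₗ δ d) ∧
    ∀ f : D (d+1) →ₗ[R] R, f ∘ₗ δ (d+1) = 0 → ∃ (r : R) (g : D d →ₗ[R] R), f = r • z + g ∘ₗ δ d
  htpy : ∀ r ∈ IsLocalRing.maximalIdeal R, ∀ i, ∃ (s : D (i+1) →ₗ[R] D (i+1+1))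
    (t : D i →ₗ[R] D (i+1)), ∀ x, r • x = δ (i+1) (s x) + t (δ i x)

lemma exists_gdata {A : Type u} [CommRing A] [IsLocalRing A] [IsNoetherianRing A]
    (h : IsGorensteinLocalRing A) :
    ∃ (d : ℕ) (n : ℕ → ℕ) (δ : ∀ i, (Fin (n (i+1)) → A) →ₗ[A] (Fin (n i) → A)),
      GData A d (fun i => Fin (n i) → A) δ := by
  obtain ⟨d, h1, ⟨e⟩⟩ := h
  let k := IsLocalRing.ResidueField A
  let ε0 : (Fin 1 → A) →ₗ[A] k := Algebra.linearMap A k ∘ₗ LinearMap.proj 0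
  have hε0 : Function.Surjective ε0 := by
    refine Function.Surjective.comp (g := Algebra.linearMap A k) IsLocalRing.residue_surjective ?_
    exact LinearMap.proj_surjective 0
  obtain ⟨n, h0, D, hD0, hD⟩ := exists_finFree_seq (LinearMap.ker ε0)
  let ε : (Fin (n 0) → A) →ₗ[A] k := ε0 ∘ₗ LinearMap.funLeft A A (finCongr h0).symm
  have hε : Function.Surjective ε := hε0.comp
    (LinearMap.funLeft_surjective_of_injective A A _ (finCongr h0).symm.injective)
  have hDε : Function.Exact (D 0) ε := by
    rw [LinearMap.exact_iff, hD0]; rfl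
  let P := finRes D hD ε hε hDε
  refine ⟨d, fun i => n (i-1), fun i => (P.complex.d i (i-1)).hom, ?_, ?_, ?_, ?_, ?_⟩
  · rw [P.complex.shape 0 (0-1) (by simp)]; rfl
  · intro i
    have := P.complex.d_comp_d (i+1) i (i-1)
    exact congrArg ModuleCat.Hom.hom this
  · intro i hi f hf
    obtain ⟨φ, -, hφ⟩ := ext_desc P (ModuleCat.of A A) i
    have := h1 i hi
    exact (hφ ⟨f, hf⟩).1 (Subsingleton.elim _ _)
  · obtain ⟨φ, hφs, hφ⟩ := ext_desc P (ModuleCat.of A A) d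
    obtain ⟨z, hz⟩ := hφs (e.symm 1)
    refine ⟨z.1, z.2, ?_, ?_, ?_⟩
    · intro hg
      have h2 := (hφ z).2 hg
      rw [hz, LinearEquiv.map_eq_zero_iff] at h2
      exact one_ne_zero h2
    · intro r hr
      have : φ (r • z) = 0 := by
        rw [map_smul, hz, ← map_smul, Algebra.smul_def, mul_one]
        have : algebraMap A k r = 0 := (IsLocalRing.residue_eq_zero_iff r).2 hr
        rw [this, map_zero]
      exact (hφ _).1 this
    · intro f hf
      obtain ⟨r, hr⟩ := IsLocalRing.residue_surjective (e (φ ⟨f, hf⟩))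
      have : φ (⟨f, hf⟩ - r • z) = 0 := by
        rw [map_sub, map_smul, hz, ← map_smul, Algebra.smul_def, mul_one]
        have : algebraMap A k r = e (φ ⟨f, hf⟩) := hr
        rw [this, e.symm_apply_apply, sub_self]
      obtain ⟨g, hg⟩ := (hφ _).1 this
      refine ⟨r, g, ?_⟩
      exact eq_add_of_sub_eq' hg
  · intro r hr i
    have h0 : (r • 𝟙 P.complex) ≫ P.π = 0 := by
      have : P.π.f 0 = ModuleCat.ofHom ε := 
        ChainComplex.toSingle₀Equiv_symm_apply_f_zero (V := ModuleCat.{u} A)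
              (C := resComplex D hD) (X := ModuleCat.of A k) (ModuleCat.ofHom ε) _
      refine HomologicalComplex.to_single_hom_ext ?_
      rw [HomologicalComplex.comp_f, this]
      ext x
      change ε (r • x) = 0
      refine (map_smul ε r _).trans ?_
      rw [Algebra.smul_def]
      have : algebraMap A k r = 0 := (IsLocalRing.residue_eq_zero_iff r).2 hr
      rw [this, zero_mul]
    let H := ProjectiveResolution.liftHomotopyZero _ h0
    refine ⟨(H.hom i (i+1)).hom, (H.hom (i-1) i).hom, fun x => ?_⟩
    have := H.comm i
    have h3 : prevD i H.hom = H.hom i (i+1) ≫ P.complex.d (i+1) i := prevD_eq _ (by simp)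
    have h4 : dNext i H.hom = P.complex.d i (i-1) ≫ H.hom (i-1) i := by
      cases i with
      | zero => rw [Homotopy.dNext_zero_chainComplex, P.complex.shape 0 (0-1) (by simp), Limits.zero_comp]
      | succ j => exact dNext_eq _ (by simp)
    rw [h3, h4] at this
    have := LinearMap.congr_fun (congrArg ModuleCat.Hom.hom this) x
    refine this.trans ?_
    refine (add_zero _).trans ?_
    exact add_comm _ _


lemma GData.restrict {R A : Type u} [CommRing R] [IsLocalRing R] [CommRing A] [IsLocalRing A]
    [Algebra R A] (e : R ≃ₐ[R] A) {d : ℕ} {D : ℕ → Type u} [∀ i, AddCommGroup (D i)]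
    [∀ i, Module A (D i)] [∀ i, Module R (D i)] [∀ i, IsScalarTower R A (D i)]
    {δ : ∀ i, D (i+1) →ₗ[A] D i} (h : GData A d D δ) :
    GData R d D (fun i => (δ i).restrictScalars R) := by
  have hsurj : ∀ a : A, ∃ r : R, algebraMap R A r = a := fun a => ⟨e.symm a, by
    rw [← AlgEquiv.commutes e.symm.symm]; simp⟩
  have he : ∀ r : R, e r = algebraMap R A r := fun r => e.commutes r
  have hmem : ∀ r ∈ IsLocalRing.maximalIdeal R, algebraMap R A r ∈ IsLocalRing.maximalIdeal A := by
    intro r hr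
    rw [IsLocalRing.mem_maximalIdeal, mem_nonunits_iff] at hr ⊢
    intro hu
    rw [← he] at hu
    exact hr ((MulEquiv.isUnit_map e).1 hu)
  -- extension and restriction of functionals
  let up : ∀ i, (D i →ₗ[R] R) → (D i →ₗ[A] A) := fun i f =>
    { toFun := fun x => e (f x)
      map_add' := fun x y => by simp
      map_smul' := fun a x => by
        obtain ⟨r, rfl⟩ := hsurj a
        simp [Algebra.smul_def, he] }
  let down : ∀ i, (D i →ₗ[A] A) → (D i →ₗ[R] R) := fun i f =>
    e.symm.toLinearMap ∘ₗ f.restrictScalars R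
  have hup : ∀ i f x, up i f x = e (f x) := fun _ _ _ => rfl
  have hdown : ∀ i f x, down i f x = e.symm (f x) := fun _ _ _ => rfl
  refine ⟨?_, ?_, ?_, ?_, ?_⟩
  · rw [h.zero]; rfl
  · intro i
    ext x
    exact LinearMap.congr_fun (h.comp i) x
  · intro i hi f hf
    obtain ⟨g, hg⟩ := h.ne i hi (up _ f) (by
      ext x
      have := LinearMap.congr_fun hf x
      simp only [LinearMap.comp_apply, LinearMap.restrictScalars_apply, LinearMap.zero_apply] at this
      simp [hup, this])
    refine ⟨down _ g, ?_⟩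
    ext x
    have := LinearMap.congr_fun hg x
    simp only [hup, LinearMap.comp_apply] at this
    simp [hdown, ← this]
  · obtain ⟨z, h1, h2, h3, h4⟩ := h.eq
    refine ⟨down _ z, ?_, ?_, ?_, ?_⟩
    · ext x
      have := LinearMap.congr_fun h1 x
      simp only [LinearMap.comp_apply, LinearMap.zero_apply] at this
      simp [hdown, this]
    · rintro ⟨g, hg⟩
      refine h2 ⟨up _ g, ?_⟩
      ext x
      have := LinearMap.congr_fun hg x
      simp only [hdown, LinearMap.comp_apply, LinearMap.restrictScalars_apply] at this
      simp [hup, ← this]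
    · intro r hr
      obtain ⟨g, hg⟩ := h3 _ (hmem r hr)
      refine ⟨down _ g, ?_⟩
      ext x
      have := LinearMap.congr_fun hg x
      simp only [LinearMap.comp_apply, LinearMap.smul_apply, algebraMap_smul] at this
      simp only [LinearMap.comp_apply, LinearMap.smul_apply, hdown, LinearMap.restrictScalars_apply,
        ← this, map_smul]
    · intro f hf
      obtain ⟨a, g, hg⟩ := h4 (up _ f) (by
        ext x
        have := LinearMap.congr_fun hf x
        simp only [LinearMap.comp_apply, LinearMap.restrictScalars_apply, LinearMap.zero_apply] at this
        simp [hup, this])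
      obtain ⟨r, rfl⟩ := hsurj a
      refine ⟨r, down _ g, ?_⟩
      ext x
      have := LinearMap.congr_fun hg x
      simp only [LinearMap.comp_apply, LinearMap.smul_apply, LinearMap.add_apply, algebraMap_smul, hup] at this
      apply e.injective
      rw [this]
      simp [hdown]
      rw [he, Algebra.smul_def]
  · intro r hr i
    obtain ⟨s, t, hst⟩ := h.htpy _ (hmem r hr) i
    refine ⟨s.restrictScalars R, t.restrictScalars R, fun x => ?_⟩
    have := hst x
    rw [algebraMap_smul] at this
    exact this

lemma exists_gdata' {R : Type u} [CommRing R] [IsLocalRing R] [IsNoetherianRing R]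
    (hR : ∀ (p : Ideal R) (hp : p.IsPrime),
      letI := hp
      IsGorensteinLocalRing (Localization.AtPrime p)) :
    ∃ (d : ℕ) (D : ℕ → ModuleCat.{u} R) (_ : ∀ i, Module.Free R (D i))
      (_ : ∀ i, Module.Finite R (D i)) (δ : ∀ i, D (i+1) →ₗ[R] D i),
      GData R d (fun i => D i) δ := by
  let m := IsLocalRing.maximalIdeal R
  let A := Localization.AtPrime m
  haveI : IsNoetherianRing A := IsLocalization.isNoetherianRing m.primeCompl A inferInstance
  obtain ⟨d, n, δ, h⟩ := exists_gdata (A := A) (hR m inferInstance)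
  let e : R ≃ₐ[R] A := IsLocalization.atUnits R m.primeCompl (by
    intro x hx
    have : x ∉ m := hx
    show IsUnit x
    simpa [m] using this)
  have hres := h.restrict e
  haveI : Module.Free R A := Module.Free.of_equiv e.toLinearEquiv
  haveI : Module.Finite R A := Module.Finite.equiv e.toLinearEquiv
  exact ⟨d, fun i => ModuleCat.of R (Fin (n i) → A), fun i => inferInstanceAs (Module.Free R (Fin (n i) → A)), fun i => inferInstanceAs (Module.Finite R (Fin (n i) → A)), _, hres⟩


section FlatCoeff
open TensorProduct
variable {R : Type u} [CommRing R]

lemma dualTensorHom_nat {D1 D2 S : Type u} [AddCommGroup D1] [Module R D1] [AddCommGroup D2]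
    [Module R D2] [AddCommGroup S] [Module R S] (δ : D2 →ₗ[R] D1) (w : Module.Dual R D1 ⊗[R] S) :
    dualTensorHom R D2 S (LinearMap.rTensor S δ.dualMap w) = dualTensorHom R D1 S w ∘ₗ δ := by
  induction w using TensorProduct.induction_on with
  | zero => simp
  | tmul x y => ext a; simp
  | add x y hx hy => rw [map_add, map_add, hx, hy, map_add, LinearMap.add_comp]

/-- Elements of `Hom(D1, S)` killed by composition with `δ` come from a tensor. -/
lemma flat_cocycle {N D1 D2 S : Type u} [AddCommGroup N] [Module R N] [AddCommGroup D1] [Module R D1]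
    [AddCommGroup D2] [Module R D2] [AddCommGroup S] [Module R S] [Module.Flat R S]
    [Module.Free R D1] [Module.Finite R D1] [Module.Free R D2] [Module.Finite R D2]
    (ψ : N →ₗ[R] Module.Dual R D1) (δ : D2 →ₗ[R] D1)
    (h : Function.Exact ψ δ.dualMap) (f : D1 →ₗ[R] S) (hf : f ∘ₗ δ = 0) :
    ∃ w : N ⊗[R] S, f = dualTensorHom R D1 S (ψ.rTensor S w) := by
  have hex := Module.Flat.rTensor_exact S h
  obtain ⟨w, rfl⟩ := (dualTensorHom_bijective (R := R) (M := D1) (N := S)).2 f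
  rw [← dualTensorHom_nat] at hf
  have h0 : LinearMap.rTensor S δ.dualMap w = 0 :=
    (dualTensorHom_bijective (R := R) (M := D2) (N := S)).1 (by rw [hf, map_zero])
  obtain ⟨v, rfl⟩ := (hex w).1 h0
  exact ⟨v, rfl⟩

variable {d : ℕ} {D : ℕ → Type u} [∀ i, AddCommGroup (D i)] [∀ i, Module R (D i)]
  [∀ i, Module.Free R (D i)] [∀ i, Module.Finite R (D i)] {δ : ∀ i, D (i+1) →ₗ[R] D i}
  {S : Type u} [AddCommGroup S] [Module R S]

lemma GData.flat_ne [IsLocalRing R] (h : GData R d D δ) [Module.Flat R S] (i : ℕ) (hi : i ≠ d)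
    (f : D (i+1) →ₗ[R] S) (hf : f ∘ₗ δ (i+1) = 0) : ∃ g : D i →ₗ[R] S, f = g ∘ₗ δ i := by
  obtain ⟨w, rfl⟩ := flat_cocycle (δ i).dualMap (δ (i+1)) (by
    intro y
    constructor
    · intro hy
      obtain ⟨g, rfl⟩ := h.ne i hi y hy
      exact ⟨g, rfl⟩
    · rintro ⟨g, rfl⟩
      change (g ∘ₗ δ i) ∘ₗ δ (i+1) = 0
      rw [LinearMap.comp_assoc, h.comp, LinearMap.comp_zero]) f hf
  exact ⟨_, dualTensorHom_nat _ _⟩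

lemma GData.flat_exists [IsLocalRing R] (h : GData R d D δ) [Module.FaithfullyFlat R S] :
    ∃ f : D (d+1) →ₗ[R] S, f ∘ₗ δ (d+1) = 0 ∧ ¬ ∃ g : D d →ₗ[R] S, f = g ∘ₗ δ d := by
  by_contra! hcon
  obtain ⟨z, hz1, hz2, -, -⟩ := h.eq
  apply hz2
  have hex : Function.Exact ((δ d).dualMap.rTensor S) ((δ (d+1)).dualMap.rTensor S) := by
    intro w
    constructor
    · intro hw
      obtain ⟨g, hg⟩ := hcon (dualTensorHom R _ S w) (by rw [← dualTensorHom_nat, hw, map_zero])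
      obtain ⟨v, rfl⟩ := (dualTensorHom_bijective (R := R) (M := D d) (N := S)).2 g
      rw [← dualTensorHom_nat] at hg
      exact ⟨v, ((dualTensorHom_bijective (R := R) (M := D (d+1)) (N := S)).1 hg).symm⟩
    · rintro ⟨v, rfl⟩
      rw [← LinearMap.comp_apply, ← LinearMap.rTensor_comp]
      have : (δ (d+1)).dualMap ∘ₗ (δ d).dualMap = 0 := by
        rw [LinearMap.dualMap_comp_dualMap, h.comp]; ext; simp
      rw [this]; simp
  rw [Module.FaithfullyFlat.rTensor_exact_iff_exact] at hex
  obtain ⟨g, hg⟩ := (hex z).1 hz1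
  exact ⟨g, hg.symm⟩

lemma GData.flat_eq [IsLocalRing R] (h : GData R d D δ) [Module.Flat R S] (e : S)
    (he : ∀ s : S, ∃ r : R, s - r • e ∈ IsLocalRing.maximalIdeal R • (⊤ : Submodule R S)) :
    ∃ z : D (d+1) →ₗ[R] S, z ∘ₗ δ (d+1) = 0 ∧ ∀ f : D (d+1) →ₗ[R] S, f ∘ₗ δ (d+1) = 0 →
      ∃ (r : R) (g : D d →ₗ[R] S), f = r • z + g ∘ₗ δ d := by
  obtain ⟨z, hz1, -, hz3, hz4⟩ := h.eq
  have hz1' : ∀ x, z (δ (d+1) x) = 0 := fun x => LinearMap.congr_fun hz1 x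
  have key : ∀ s ∈ IsLocalRing.maximalIdeal R • (⊤ : Submodule R S),
      ∃ g : D d →ₗ[R] S, z.smulRight s = g ∘ₗ δ d := by
    intro s hs
    refine Submodule.smul_induction_on hs (fun r hr n hn => ?_) (fun x y hx hy => ?_)
    · obtain ⟨g, hg⟩ := hz3 r hr
      refine ⟨g.smulRight n, ?_⟩
      ext x
      have := LinearMap.congr_fun hg x
      simp only [LinearMap.smul_apply, LinearMap.comp_apply, smul_eq_mul] at this
      simp [← this, smul_smul, mul_comm]
    · obtain ⟨g, hg⟩ := hx
      obtain ⟨g', hg'⟩ := hy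
      refine ⟨g + g', ?_⟩
      rw [LinearMap.add_comp, ← hg, ← hg']
      ext; simp
  refine ⟨z.smulRight e, by ext x; simp [hz1'], fun f hf => ?_⟩
  obtain ⟨w, rfl⟩ := flat_cocycle ((LinearMap.toSpanSingleton R _ z).coprod (δ d).dualMap) (δ (d+1)) (by
    intro y
    constructor
    · intro hy
      obtain ⟨r, g, rfl⟩ := hz4 y hy
      exact ⟨(r, g), by simp [LinearMap.dualMap_apply']⟩
    · rintro ⟨⟨r, g⟩, rfl⟩
      ext x
      have := LinearMap.congr_fun (h.comp d) x
      simp only [LinearMap.comp_apply, LinearMap.zero_apply] at this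
      simp [hz1', this]) f hf
  clear hf
  induction w using TensorProduct.induction_on with
  | zero => exact ⟨0, 0, by simp⟩
  | add x y hx hy =>
    obtain ⟨r, g, hr⟩ := hx
    obtain ⟨r', g', hr'⟩ := hy
    refine ⟨r + r', g + g', ?_⟩
    rw [map_add, map_add, hr, hr', LinearMap.add_comp, add_smul]; abel
  | tmul x s =>
    obtain ⟨r, g⟩ := x
    obtain ⟨a, ha⟩ := he s
    obtain ⟨g', hg'⟩ := key _ ha
    refine ⟨r * a, r • g' + g.smulRight s, ?_⟩
    rw [LinearMap.add_comp, LinearMap.smul_comp, ← hg']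
    ext x
    simp [smul_smul, add_smul, mul_comm, mul_assoc, mul_left_comm, smul_sub]
    abel
end FlatCoeff

/-- Elementary data for the complex with coefficients in `T`. -/
structure TData (R : Type u) [CommRing R] [IsLocalRing R] (T : Type u) [AddCommGroup T] [Module R T]
    (d : ℕ) (C : ℕ → Type u)
    [∀ i, AddCommGroup (C i)] [∀ i, Module R (C i)] (δ : ∀ i, C (i+1) →ₗ[R] C i) : Prop where
  zero : δ 0 = 0
  comp : ∀ i x, δ i (δ (i+1) x) = 0
  ne : ∀ i, i ≠ d → ∀ f : C (i+1) →ₗ[R] T, f ∘ₗ δ (i+1) = 0 → ∃ g : C i →ₗ[R] T, f = g ∘ₗ δ i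
  ex : ∃ f : C (d+1) →ₗ[R] T, f ∘ₗ δ (d+1) = 0 ∧ ¬ ∃ g : C d →ₗ[R] T, f = g ∘ₗ δ d
  eq : ∃ z : C (d+1) →ₗ[R] T, z ∘ₗ δ (d+1) = 0 ∧
    ∀ f : C (d+1) →ₗ[R] T, f ∘ₗ δ (d+1) = 0 → ∃ (r : R) (g : C d →ₗ[R] T), f = r • z + g ∘ₗ δ d
  kill : ∀ r ∈ IsLocalRing.maximalIdeal R, ∀ i x, δ i x = 0 → ∃ y, r • x = δ (i+1) y

open TensorProduct in
lemma exists_tdata {R : Type u} [CommRing R] [IsLocalRing R] [IsNoetherianRing R]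
    (T : Type u) [AddCommGroup T] [Module R T]
    (χ : AdicCompletion (IsLocalRing.maximalIdeal R) R →ₐ[R] Module.End R T)
    (hχ : Function.Bijective χ)
    {d : ℕ} {D : ℕ → Type u} [∀ i, AddCommGroup (D i)] [∀ i, Module R (D i)]
    [∀ i, Module.Free R (D i)] [∀ i, Module.Finite R (D i)] {δ : ∀ i, D (i+1) →ₗ[R] D i}
    (h : GData R d D δ) :
    TData R T d (fun i => D i ⊗[R] T) (fun i => (δ i).rTensor T) := by
  let m := IsLocalRing.maximalIdeal R
  let S := AdicCompletion m R
  have hm : m • (⊤ : Submodule R S) = LinearMap.ker (AdicCompletion.eval m R 1) := by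
    rw [← AdicCompletion.pow_smul_top_eq_ker_eval (IsNoetherian.noetherian m), pow_one]
  have hne : m • (⊤ : Submodule R S) ≠ ⊤ := by
    rw [hm]
    intro h
    rw [LinearMap.ker_eq_top] at h
    have hs := AdicCompletion.eval_surjective m R 1
    have hsub : Subsingleton (R ⧸ (m ^ 1 • ⊤ : Submodule R R)) := ⟨fun a b => by
      obtain ⟨a, rfl⟩ := hs a
      obtain ⟨b, rfl⟩ := hs b
      rw [h]; rfl⟩
    rw [Submodule.Quotient.subsingleton_iff] at hsub
    simp at hsub
    exact Ideal.IsPrime.ne_top' hsub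
  have hff : Module.FaithfullyFlat R S :=
    { submodule_ne_top := by
        intro m' hm'
        rw [IsLocalRing.eq_maximalIdeal hm']
        exact hne }
  have he : ∀ s : S, ∃ r : R, s - r • (1 : S) ∈ m • (⊤ : Submodule R S) := by
    intro s
    obtain ⟨r, hr⟩ := Submodule.mkQ_surjective _ (AdicCompletion.eval m R 1 s)
    refine ⟨r, ?_⟩
    rw [hm, LinearMap.mem_ker, map_sub, ← hr, map_smul, sub_eq_zero]
    change _ = r • (Submodule.Quotient.mk (1 : R))
    rw [← Submodule.Quotient.mk_smul]
    simp
  let eS : S ≃ₗ[R] (T →ₗ[R] T) := LinearEquiv.ofBijective χ.toLinearMap hχ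
  -- conversion
  let Φ : ∀ i, (D i ⊗[R] T →ₗ[R] T) → (D i →ₗ[R] S) := fun i f =>
    eS.symm.toLinearMap ∘ₗ TensorProduct.curry f
  let Ψ : ∀ i, (D i →ₗ[R] S) → (D i ⊗[R] T →ₗ[R] T) := fun i f =>
    TensorProduct.lift (eS.toLinearMap ∘ₗ f)
  have hΨΦ : ∀ i f, Ψ i (Φ i f) = f := fun i f => by
    apply TensorProduct.ext'
    intro x y
    simp [Ψ, Φ]
  have hΦΨ : ∀ i f, Φ i (Ψ i f) = f := fun i f => by
    ext1 x
    simp only [Ψ, Φ, LinearMap.comp_apply]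
    apply eS.injective
    ext y
    simp
  have hΦc : ∀ i f, Φ (i+1) (f ∘ₗ (δ i).rTensor T) = Φ i f ∘ₗ δ i := fun i f => by
    ext1 x
    simp only [Φ, LinearMap.comp_apply]
    apply eS.injective
    ext y
    simp
  have hΨc : ∀ i f, Ψ (i+1) (f ∘ₗ δ i) = Ψ i f ∘ₗ (δ i).rTensor T := fun i f => by
    apply TensorProduct.ext'
    intro x y
    simp [Ψ]
  have hΦ0 : ∀ i, Φ i 0 = 0 := fun i => by ext1 x; simp only [Φ, LinearMap.comp_apply]; apply eS.injective; ext y; simp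
  have hΨ0 : ∀ i, Ψ i 0 = 0 := fun i => by apply TensorProduct.ext'; intro x y; simp [Ψ]
  have hΨl : ∀ i (r : R) f g, Ψ i (r • f + g) = r • Ψ i f + Ψ i g := fun i r f g => by
    apply TensorProduct.ext'
    intro x y
    simp [Ψ]
  have hcomp : ∀ i x, (δ i).rTensor T ((δ (i+1)).rTensor T x) = 0 := fun i x => by
    rw [← LinearMap.comp_apply, ← LinearMap.rTensor_comp, h.comp]; simp
  refine ⟨?_, hcomp, ?_, ?_, ?_, ?_⟩
  · simp [h.zero]
  · intro i hi f hf
    obtain ⟨g, hg⟩ := h.flat_ne i hi (Φ _ f) (by rw [← hΦc, hf, hΦ0])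
    refine ⟨Ψ _ g, ?_⟩
    rw [← hΨc, ← hg, hΨΦ]
  · obtain ⟨f, hf, hn⟩ := h.flat_exists (S := S)
    refine ⟨Ψ _ f, by rw [← hΨc, hf, hΨ0], fun ⟨g, hg⟩ => hn ⟨Φ _ g, ?_⟩⟩
    rw [← hΦc, ← hg, hΦΨ]
  · obtain ⟨z, hz, hf⟩ := h.flat_eq (S := S) 1 he
    refine ⟨Ψ _ z, by rw [← hΨc, hz, hΨ0], fun f hf' => ?_⟩
    obtain ⟨r, g, hg⟩ := hf (Φ _ f) (by rw [← hΦc, hf', hΦ0])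
    refine ⟨r, Ψ _ g, ?_⟩
    rw [← hΨc, ← hΨl, ← hg, hΨΦ]
  · intro r hr i x hx
    obtain ⟨s, t, hst⟩ := h.htpy r hr i
    refine ⟨s.rTensor T x, ?_⟩
    have : r • (LinearMap.id : D (i+1) →ₗ[R] D (i+1)) = δ (i+1) ∘ₗ s + t ∘ₗ δ i := by
      ext x; simp [hst x]
    have h2 := congrArg (fun l => LinearMap.rTensor T l x) this
    simp only [LinearMap.rTensor_add, LinearMap.rTensor_comp, LinearMap.rTensor_smul,
      LinearMap.add_apply, LinearMap.comp_apply, hx, map_zero, add_zero] at h2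
    simpa using h2


section ExtVanish
variable {R : Type u} [CommRing R]

/-- Vanishing of `Ext^j(M, T)`. -/
def XV (R : Type u) [CommRing R] (T M : Type u) [AddCommGroup T] [Module R T]
    [AddCommGroup M] [Module R M] (j : ℕ) : Prop :=
  ∀ α : Abelian.Ext (ModuleCat.of R M) (ModuleCat.of R T) j, α = 0

variable {T A B C : Type u} [AddCommGroup T] [Module R T] [AddCommGroup A] [Module R A]
  [AddCommGroup B] [Module R B] [AddCommGroup C] [Module R C]

lemma XV.of_equiv {j : ℕ} (h : XV R T A j) (e : A ≃ₗ[R] B) : XV R T B j := by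
  intro α
  have h1 : (Abelian.Ext.mk₀ (ModuleCat.ofHom e.toLinearMap)).comp α (zero_add j) = 0 := h _
  have h2 : (Abelian.Ext.mk₀ (ModuleCat.ofHom e.symm.toLinearMap)).comp
    ((Abelian.Ext.mk₀ (ModuleCat.ofHom e.toLinearMap)).comp α (zero_add j)) (zero_add j) = α := by
    rw [Abelian.Ext.mk₀_comp_mk₀_assoc, ← ModuleCat.ofHom_comp]
    have : e.toLinearMap ∘ₗ e.symm.toLinearMap = LinearMap.id := by ext x; simp
    rw [this, ModuleCat.ofHom_id, Abelian.Ext.mk₀_id_comp]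
  rw [← h2, h1, Abelian.Ext.comp_zero]

lemma XV.of_subsingleton [Subsingleton A] (j : ℕ) : XV R T A j := by
  intro α
  rw [← Abelian.Ext.mk₀_id_comp α]
  have : 𝟙 (ModuleCat.of R A) = 0 := by ext x; exact Subsingleton.elim _ _
  rw [this, Abelian.Ext.mk₀_zero, Abelian.Ext.zero_comp]

lemma mkSES (f : A →ₗ[R] B) (g : B →ₗ[R] C) (hf : Function.Injective f) (hfg : Function.Exact f g)
    (hg : Function.Surjective g) :
    (ShortComplex.mk (ModuleCat.ofHom f) (ModuleCat.ofHom g) (by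
      rw [← ModuleCat.ofHom_comp, hfg.linearMap_comp_eq_zero]; rfl)).ShortExact :=
  ModuleCat.shortComplex_shortExact _ hfg hf hg


lemma XV.left {j : ℕ} (f : A →ₗ[R] B) (g : B →ₗ[R] C) (hf : Function.Injective f)
    (hfg : Function.Exact f g) (hg : Function.Surjective g) (h2 : XV R T B j) (h3 : XV R T C (j+1)) : XV R T A j := by
  intro α
  obtain ⟨x, hx⟩ := Abelian.Ext.contravariant_sequence_exact₁ (mkSES f g hf hfg hg) _ α (add_comm 1 j)
    (h3 _)
  rw [← hx, h2 x, Abelian.Ext.comp_zero]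

lemma XV.mid {j : ℕ} (f : A →ₗ[R] B) (g : B →ₗ[R] C) (hf : Function.Injective f)
    (hfg : Function.Exact f g) (hg : Function.Surjective g) (h1 : XV R T A j) (h3 : XV R T C j) : XV R T B j := by
  intro α
  obtain ⟨x, hx⟩ := Abelian.Ext.contravariant_sequence_exact₂ (mkSES f g hf hfg hg) _ α (h1 _)
  rw [← hx, h3 x, Abelian.Ext.comp_zero]

lemma XV.right {j : ℕ} (f : A →ₗ[R] B) (g : B →ₗ[R] C) (hf : Function.Injective f)
    (hfg : Function.Exact f g) (hg : Function.Surjective g) (h1 : XV R T A j) (h2 : XV R T B (j+1)) : XV R T C (j+1) := by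
  intro α
  obtain ⟨x, hx⟩ := Abelian.Ext.contravariant_sequence_exact₃ (mkSES f g hf hfg hg) _ α (h2 _) (add_comm 1 j)
  rw [← hx, h1 x, Abelian.Ext.comp_zero]

lemma XV.extend (f : A →ₗ[R] B) (g : B →ₗ[R] C) (hf : Function.Injective f)
    (hfg : Function.Exact f g) (hg : Function.Surjective g) (h3 : XV R T C 1) (φ : A →ₗ[R] T) : ∃ ψ : B →ₗ[R] T, φ = ψ ∘ₗ f := by
  obtain ⟨x, hx⟩ := Abelian.Ext.contravariant_sequence_exact₁ (mkSES f g hf hfg hg) _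
    (Abelian.Ext.mk₀ (ModuleCat.ofHom φ)) (add_comm 1 0) (h3 _)
  obtain ⟨ψ, rfl⟩ := (Abelian.Ext.mk₀_bijective _ _).2 x
  rw [Abelian.Ext.mk₀_comp_mk₀] at hx
  have := (Abelian.Ext.mk₀_bijective _ _).1 hx
  refine ⟨ψ.hom, ?_⟩
  have h2 := congrArg ModuleCat.Hom.hom this
  exact h2.symm

lemma XV.of_extend (f : A →ₗ[R] B) (g : B →ₗ[R] C) (hf : Function.Injective f)
    (hfg : Function.Exact f g) (hg : Function.Surjective g) (h2 : XV R T B 1) (h : ∀ φ : A →ₗ[R] T, ∃ ψ : B →ₗ[R] T, φ = ψ ∘ₗ f) :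
    XV R T C 1 := by
  intro α
  obtain ⟨x, hx⟩ := Abelian.Ext.contravariant_sequence_exact₃ (mkSES f g hf hfg hg) _ α (h2 _) (add_comm 1 0)
  obtain ⟨φ, rfl⟩ := (Abelian.Ext.mk₀_bijective _ _).2 x
  obtain ⟨ψ, hψ⟩ := h φ.hom
  have : φ = ModuleCat.ofHom f ≫ ModuleCat.ofHom ψ := by
    ext1; exact hψ
  rw [← hx, this, ← Abelian.Ext.mk₀_comp_mk₀]
  exact (mkSES f g hf hfg hg).extClass_comp_assoc _

lemma XV.lift (f : A →ₗ[R] B) (g : B →ₗ[R] C) (hf : Function.Injective f)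
    (hfg : Function.Exact f g) (hg : Function.Surjective g) {H : Type u} [AddCommGroup H] [Module R H] (h : XV R A H 1) (φ : H →ₗ[R] C) :
    ∃ ψ : H →ₗ[R] B, φ = g ∘ₗ ψ := by
  obtain ⟨x, hx⟩ := Abelian.Ext.covariant_sequence_exact₃ _ (mkSES f g hf hfg hg) 
    (Abelian.Ext.mk₀ (ModuleCat.ofHom φ)) (zero_add 1) (h _)
  obtain ⟨ψ, rfl⟩ := (Abelian.Ext.mk₀_bijective _ _).2 x
  rw [Abelian.Ext.mk₀_comp_mk₀] at hx
  have := (Abelian.Ext.mk₀_bijective _ _).1 hx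
  refine ⟨ψ.hom, ?_⟩
  have h2 := congrArg ModuleCat.Hom.hom this
  exact h2.symm

lemma XV.pi {j : ℕ} (h : XV R T T j) (n : ℕ) : XV R T (Fin n → T) j := by
  induction n with
  | zero => exact XV.of_subsingleton j
  | succ n ih =>
    refine XV.mid (LinearMap.single R (fun _ : Fin (n+1) => T) 0)
      (LinearMap.funLeft R T Fin.succ) ?_ ?_ ?_ h ih
    · exact Pi.single_injective (M := fun _ : Fin (n+1) => T) 0
    · intro y
      constructor
      · intro hy
        refine ⟨y 0, ?_⟩
        ext i
        refine Fin.cases ?_ (fun i => ?_) i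
        · simp
        · have := congrFun hy i
          simp [LinearMap.funLeft_apply] at this
          simp [this]
      · rintro ⟨t, rfl⟩
        ext i
        simp [LinearMap.funLeft_apply]
    · exact LinearMap.funLeft_surjective_of_injective _ _ _ (Fin.succ_injective n)

open TensorProduct in
lemma XV.tensor [Nontrivial R] {j : ℕ} (h : XV R T T j) (D : Type u) [AddCommGroup D] [Module R D] [Module.Free R D]
    [Module.Finite R D] : XV R T (D ⊗[R] T) j := by
  let b := Module.finBasis R D
  exact (h.pi _).of_equiv ((TensorProduct.piScalarRight R R T _).symm ≪≫ₗ
    TensorProduct.comm R _ _ ≪≫ₗ LinearEquiv.rTensor T b.equivFun.symm)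
end ExtVanish


section Core
variable {R : Type u} [CommRing R] [IsLocalRing R]

lemma exists_map_socle {H M : Type u} [AddCommGroup H] [Module R H] [AddCommGroup M] [Module R M]
    (hH : ∀ r ∈ IsLocalRing.maximalIdeal R, ∀ y : H, r • y = 0) (h : H) (hh : h ≠ 0) (x : M)
    (hx : ∀ r ∈ IsLocalRing.maximalIdeal R, r • x = 0) : ∃ φ : H →ₗ[R] M, φ h = x := by
  let m := IsLocalRing.maximalIdeal R
  letI : Field (R ⧸ m) := Ideal.Quotient.field m
  have htor : Module.IsTorsionBySet R H m := fun y r => hH r r.2 y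
  letI : Module (R ⧸ m) H := htor.module
  haveI : IsScalarTower R (R ⧸ m) H := htor.isScalarTower
  have h1 : ¬ ∀ φ : Module.Dual (R ⧸ m) H, φ h = 0 := fun h2 =>
    hh ((Module.forall_dual_apply_eq_zero_iff (R ⧸ m) h).1 h2)
  push Not at h1
  obtain ⟨φ, hφ⟩ := h1
  let κ : (R ⧸ m) →ₗ[R] M := Submodule.liftQ m (LinearMap.toSpanSingleton R M x) (fun r hr => by
    simpa using hx r hr)
  refine ⟨κ ∘ₗ ((φ h)⁻¹ • φ).restrictScalars R, ?_⟩
  have : ((φ h)⁻¹ • φ) h = Submodule.Quotient.mk (1 : R) := by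
    change (φ h)⁻¹ * φ h = 1
    exact inv_mul_cancel₀ hφ
  rw [LinearMap.comp_apply, LinearMap.restrictScalars_apply, this]
  exact (Submodule.liftQ_apply _ _ _).trans (by simp)

variable {T : Type u} [AddCommGroup T] [Module R T] {d : ℕ} {C : ℕ → Type u}
  [∀ i, AddCommGroup (C i)] [∀ i, Module R (C i)] {δ : ∀ i, C (i+1) →ₗ[R] C i}

lemma TData.range_le (h : TData R T d C δ) (i : ℕ) :
    LinearMap.range (δ (i+1)) ≤ LinearMap.ker (δ i) := by
  rintro _ ⟨y, rfl⟩
  exact h.comp i y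

lemma exact_subtype_rangeRestrict {M N : Type u} [AddCommGroup M] [Module R M] [AddCommGroup N]
    [Module R N] (f : M →ₗ[R] N) :
    Function.Exact (LinearMap.ker f).subtype f.rangeRestrict := by
  rw [LinearMap.exact_iff, LinearMap.ker_rangeRestrict, Submodule.range_subtype]

/-- maps on homology `Z/B` extend to maps on `C (i+1)` -/
lemma TData.extend_homology (h : TData R T d C δ) (i : ℕ)
    (hX : XV R T (LinearMap.range (δ i)) 1) (z : C (i+1)) (hz : δ i z = 0)
    (hz' : z ∉ LinearMap.range (δ (i+1))) (x : T)
    (hx : ∀ r ∈ IsLocalRing.maximalIdeal R, r • x = 0) :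
    ∃ ψ : C (i+1) →ₗ[R] T, ψ ∘ₗ δ (i+1) = 0 ∧ ψ z = x := by
  let Z := LinearMap.ker (δ i)
  let B := (LinearMap.range (δ (i+1))).submoduleOf Z
  obtain ⟨φ, hφ⟩ := exists_map_socle (H := Z ⧸ B) (by
    intro r hr y
    obtain ⟨⟨y, hy⟩, rfl⟩ := Submodule.mkQ_surjective _ y
    obtain ⟨w, hw⟩ := h.kill r hr i y hy
    rw [← map_smul, Submodule.mkQ_apply, Submodule.Quotient.mk_eq_zero]
    exact ⟨w, hw.symm⟩) (Submodule.Quotient.mk ⟨z, hz⟩) (by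
    rw [Ne, Submodule.Quotient.mk_eq_zero]
    exact hz') x hx
  obtain ⟨ψ, hψ⟩ := XV.extend Z.subtype (δ i).rangeRestrict Z.injective_subtype
    (exact_subtype_rangeRestrict _) (LinearMap.surjective_rangeRestrict _) hX (φ ∘ₗ B.mkQ)
  refine ⟨ψ, ?_, ?_⟩
  · ext y
    have h1 := LinearMap.congr_fun hψ ⟨δ (i+1) y, h.comp i y⟩
    have h2 : B.mkQ ⟨δ (i+1) y, h.comp i y⟩ = 0 := by
      rw [Submodule.mkQ_apply, Submodule.Quotient.mk_eq_zero]
      exact ⟨y, rfl⟩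
    simp only [LinearMap.comp_apply, h2, map_zero] at h1
    exact h1.symm
  · have h1 := LinearMap.congr_fun hψ ⟨z, hz⟩
    rw [← hφ]
    exact h1.symm

lemma TData.induct (h : TData R T d C δ) (hC : ∀ i j, XV R T (C i) (j+1)) (x : T) (hx0 : x ≠ 0)
    (hx : ∀ r ∈ IsLocalRing.maximalIdeal R, r • x = 0) (i : ℕ) (hi : i ≤ d) :
    (∀ j, XV R T (LinearMap.range (δ i)) (j+1)) ∧
    ∀ j, XV R T (C i ⧸ LinearMap.range (δ i)) (j+1) := by
  induction i with
  | zero =>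
    have : LinearMap.range (δ 0) = ⊥ := by rw [h.zero]; simp
    constructor
    · intro j
      rw [this]
      exact XV.of_subsingleton _
    · intro j
      exact (hC 0 j).of_equiv (Submodule.quotEquivOfEqBot _ this).symm
  | succ i ih =>
    have ih := (ih (by lia)).1
    have hZ : ∀ j, XV R T (LinearMap.ker (δ i)) (j+1) := fun j =>
      XV.left (LinearMap.ker (δ i)).subtype (δ i).rangeRestrict (Submodule.injective_subtype _)
        (exact_subtype_rangeRestrict _) (LinearMap.surjective_rangeRestrict _) (hC _ j) (ih _)
    have hBZ : LinearMap.range (δ (i+1)) = LinearMap.ker (δ i) := by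
      refine le_antisymm (h.range_le i) fun z hz => ?_
      by_contra hz'
      obtain ⟨ψ, h1, h2⟩ := h.extend_homology i (ih 0) z hz hz' x hx
      obtain ⟨g, rfl⟩ := h.ne i (by lia) ψ h1
      rw [LinearMap.mem_ker] at hz
      rw [LinearMap.comp_apply, hz, map_zero] at h2
      exact hx0 h2.symm
    rw [hBZ]
    exact ⟨hZ, fun j => (ih j).of_equiv (δ i).quotKerEquivRange.symm⟩

lemma TData.top (h : TData R T d C δ) (hC : ∀ i j, XV R T (C i) (j+1))
    (hsoc : ∀ x : T, x ≠ 0 → ∃ r : R, r • x ≠ 0 ∧ ∀ a ∈ IsLocalRing.maximalIdeal R, a • r • x = 0) :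
    (∃ x : T, x ≠ 0 ∧ ∀ a ∈ IsLocalRing.maximalIdeal R, a • x = 0) ∧
    (∃ w : T, (∀ a ∈ IsLocalRing.maximalIdeal R, a • w = 0) ∧
      ∀ x : T, (∀ a ∈ IsLocalRing.maximalIdeal R, a • x = 0) → ∃ r : R, x = r • w) ∧
    ∃ H : ModuleCat.{u} R, Nontrivial H ∧
      (∀ a ∈ IsLocalRing.maximalIdeal R, ∀ y : H, a • y = 0) ∧ XV R T H 1 := by
  obtain ⟨f, hf1, hf2⟩ := h.ex
  have hx : ∃ x : T, x ≠ 0 ∧ ∀ a ∈ IsLocalRing.maximalIdeal R, a • x = 0 := by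
    by_contra! hcon
    have : f = 0 := by
      ext y
      by_contra hy
      obtain ⟨r, hr, hr'⟩ := hsoc _ hy
      obtain ⟨a, ha, ha'⟩ := hcon _ hr
      exact ha' (hr' a ha)
    exact hf2 ⟨0, by rw [this]; simp⟩
  obtain ⟨x, hx0, hx1⟩ := hx
  obtain ⟨hV1, hV2⟩ := h.induct hC x hx0 hx1 d le_rfl
  -- the homology is nonzero
  have hz : ∃ z, δ d z = 0 ∧ z ∉ LinearMap.range (δ (d+1)) := by
    by_contra! hcon
    apply hf2
    let f' : LinearMap.range (δ d) →ₗ[R] T :=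
      (LinearMap.ker (δ d)).liftQ f (fun z hz => by
        obtain ⟨y, rfl⟩ := hcon z hz
        exact LinearMap.congr_fun hf1 y) ∘ₗ (δ d).quotKerEquivRange.symm.toLinearMap
    obtain ⟨g, hg⟩ := XV.extend (LinearMap.range (δ d)).subtype (LinearMap.range (δ d)).mkQ
      (Submodule.injective_subtype _) (by
        rw [LinearMap.exact_iff, Submodule.ker_mkQ, Submodule.range_subtype])
      (Submodule.mkQ_surjective _) (hV2 0) f'
    refine ⟨g, ?_⟩
    ext y
    have h1 := LinearMap.congr_fun hg ⟨δ d y, y, rfl⟩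
    have h2 : (δ d).quotKerEquivRange.symm ⟨δ d y, y, rfl⟩ = Submodule.Quotient.mk y := by
      rw [LinearEquiv.symm_apply_eq]; rfl
    simp only [f', LinearMap.comp_apply, LinearEquiv.coe_coe, h2] at h1
    exact h1
  obtain ⟨z, hz0, hz1⟩ := hz
  refine ⟨⟨x, hx0, hx1⟩, ?_, ?_⟩
  · obtain ⟨z0, hz00, hz01⟩ := h.eq
    refine ⟨z0 z, fun a ha => ?_, fun y hy => ?_⟩
    · obtain ⟨y, hy⟩ := h.kill a ha d z hz0
      rw [← map_smul, hy]
      exact LinearMap.congr_fun hz00 y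
    · obtain ⟨ψ, hψ1, hψ2⟩ := h.extend_homology d (hV1 0) z hz0 hz1 y hy
      obtain ⟨r, g, rfl⟩ := hz01 ψ hψ1
      refine ⟨r, ?_⟩
      rw [← hψ2]
      simp [hz0]
  · let Bo := LinearMap.range (δ (d+1))
    -- `Ext^1(C/B, T) = 0`
    have hCB : XV R T (C (d+1) ⧸ Bo) 1 := by
      refine XV.of_extend Bo.subtype Bo.mkQ (Submodule.injective_subtype _) (by
        rw [LinearMap.exact_iff, Submodule.ker_mkQ, Submodule.range_subtype])
        (Submodule.mkQ_surjective _) (hC _ 0) fun φ => ?_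
      obtain ⟨g, hg⟩ := h.ne (d+1) (by lia) (φ ∘ₗ (δ (d+1)).rangeRestrict) (by
        ext y
        have : (δ (d+1)).rangeRestrict (δ (d+1+1) y) = 0 := Subtype.ext (h.comp (d+1) y)
        simp only [LinearMap.comp_apply, this, map_zero, LinearMap.zero_apply])
      refine ⟨g, ?_⟩
      ext ⟨_, y, rfl⟩
      exact LinearMap.congr_fun hg y
    let π : (C (d+1) ⧸ Bo) →ₗ[R] LinearMap.range (δ d) :=
      Bo.liftQ (δ d).rangeRestrict (by
        rw [LinearMap.ker_rangeRestrict]; exact h.range_le d)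
    have hπ : Function.Surjective π := by
      rintro ⟨_, y, rfl⟩
      exact ⟨Submodule.Quotient.mk y, rfl⟩
    have hker : ∀ y, π (Submodule.Quotient.mk y) = 0 ↔ δ d y = 0 := by
      intro y
      rw [← Subtype.val_inj]; rfl
    refine ⟨ModuleCat.of R (LinearMap.ker π), ?_, ?_, ?_⟩
    · refine ⟨⟨⟨Submodule.Quotient.mk z, (hker z).2 hz0⟩, 0, fun hcon => hz1 ?_⟩⟩
      have := congrArg Subtype.val hcon
      exact (Submodule.Quotient.mk_eq_zero Bo).1 this
    · rintro a ha ⟨y, hy⟩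
      obtain ⟨y, rfl⟩ := Submodule.Quotient.mk_surjective _ y
      obtain ⟨w, hw⟩ := h.kill a ha d y ((hker y).1 hy)
      apply Subtype.ext
      change a • (Submodule.Quotient.mk y : C (d+1) ⧸ Bo) = 0
      rw [← Submodule.Quotient.mk_smul, Submodule.Quotient.mk_eq_zero]
      exact ⟨w, hw.symm⟩
    · refine XV.left (LinearMap.ker π).subtype π (Submodule.injective_subtype _) ?_ hπ hCB (hV1 1)
      rw [LinearMap.exact_iff, Submodule.range_subtype]
end Core

section Hull
variable {R : Type u} [CommRing R] [IsLocalRing R]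

lemma torsion_socle {M : Type u} [AddCommGroup M] [Module R M]
    (hM : IsAdicTorsion R (IsLocalRing.maximalIdeal R) M) (x : M) (hx : x ≠ 0) :
    ∃ r : R, r • x ≠ 0 ∧ ∀ a ∈ IsLocalRing.maximalIdeal R, a • r • x = 0 := by
  classical
  have hex := hM x
  have hn := Nat.find_spec hex
  have hmin := fun k hk => Nat.find_min hex (m := k) hk
  generalize Nat.find hex = n at hn hmin
  cases n with
  | zero =>
    exact absurd (by simpa using hn 1 (by simp)) hx
  | succ n =>
    have := hmin n (by lia)
    push Not at this
    obtain ⟨r, hr, hr'⟩ := this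
    refine ⟨r, hr', fun a ha => ?_⟩
    rw [smul_smul]
    exact hn _ (by rw [pow_succ']; exact Ideal.mul_mem_mul ha hr)

lemma unit_smul_mem {M : Type u} [AddCommGroup M] [Module R M] (r : R) (x : M)
    (hx : ∀ a ∈ IsLocalRing.maximalIdeal R, a • x = 0) (hr : r • x ≠ 0) : ∃ s : R, s • r • x = x := by
  have : IsUnit r := by
    by_contra hu
    exact hr (hx r ((IsLocalRing.mem_maximalIdeal r).2 hu))
  obtain ⟨v, rfl⟩ := this
  exact ⟨((v⁻¹ : Rˣ) : R), by simp [smul_smul]⟩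

variable {E : Type u} [AddCommGroup E] [Module R E] 
  (f : IsLocalRing.ResidueField R →ₗ[R] E) 

lemma range_killed (e : E) (he : e ∈ LinearMap.range f) (a : R) (ha : a ∈ IsLocalRing.maximalIdeal R) :
    a • e = 0 := by
  obtain ⟨k, rfl⟩ := he
  rw [← map_smul, Algebra.smul_def]
  have : algebraMap R (IsLocalRing.ResidueField R) a = 0 := by
    simpa using ha
  rw [this, zero_mul, map_zero]

lemma ess_elem (hess : ∀ N : Submodule R E, N ≠ ⊥ → N ⊓ LinearMap.range f ≠ ⊥)
    (e : E) (he : e ≠ 0) : ∃ r : R, r • e ≠ 0 ∧ r • e ∈ LinearMap.range f := by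
  have h1 := hess (Submodule.span R {e}) (by simpa using he)
  rw [Submodule.ne_bot_iff] at h1
  obtain ⟨y, ⟨hy1, hy2⟩, hy0⟩ := h1
  obtain ⟨r, rfl⟩ := Submodule.mem_span_singleton.1 hy1
  exact ⟨r, hy0, hy2⟩

lemma socle_mem_range (hess : ∀ N : Submodule R E, N ≠ ⊥ → N ⊓ LinearMap.range f ≠ ⊥)
    (e : E) (he : ∀ a ∈ IsLocalRing.maximalIdeal R, a • e = 0) :
    e ∈ LinearMap.range f := by
  by_cases h0 : e = 0
  · rw [h0]; exact zero_mem _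
  obtain ⟨r, hr, hr'⟩ := ess_elem f hess e h0
  obtain ⟨s, hs⟩ := unit_smul_mem r e he hr
  rw [← hs]
  exact Submodule.smul_mem _ _ hr'

lemma hull_torsion [IsNoetherianRing R] (hess : ∀ N : Submodule R E, N ≠ ⊥ → N ⊓ LinearMap.range f ≠ ⊥)
    : IsAdicTorsion R (IsLocalRing.maximalIdeal R) E := by
  intro e
  let I : Ideal R := LinearMap.ker (LinearMap.toSpanSingleton R E e)
  have hI : ∀ r, r ∈ I ↔ r • e = 0 := fun r => by simp [I]
  have hrad : IsLocalRing.maximalIdeal R ≤ I.radical := by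
    intro r hr
    let J : ℕ →o Ideal R := ⟨fun n => LinearMap.ker (LinearMap.toSpanSingleton R E (r ^ n • e)), by
      refine monotone_nat_of_le_succ fun n s hs => ?_
      simp only [LinearMap.mem_ker, LinearMap.toSpanSingleton_apply] at hs ⊢
      rw [pow_succ', mul_smul, smul_comm, hs, smul_zero]⟩
    obtain ⟨n, hn⟩ := monotone_stabilizes_iff_noetherian.2 ‹IsNoetherianRing R› J
    refine ⟨n, (hI _).2 ?_⟩
    by_contra h0
    obtain ⟨s, hs, hs'⟩ := ess_elem f hess _ h0
    apply hs
    have h1 : s ∈ J (n+1) := by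
      change s ∈ LinearMap.ker (LinearMap.toSpanSingleton R E (r ^ (n+1) • e))
      simp only [LinearMap.mem_ker, LinearMap.toSpanSingleton_apply]
      rw [pow_succ', mul_smul, smul_comm]
      exact range_killed f _ hs' r hr
    rw [← hn (n+1) (by lia)] at h1
    change s ∈ LinearMap.ker (LinearMap.toSpanSingleton R E (r ^ n • e)) at h1
    simpa using h1
  obtain ⟨n, hn⟩ := Ideal.exists_pow_le_of_le_radical_of_fg hrad (IsNoetherian.noetherian _)
  exact ⟨n, fun r hr => (hI r).1 (hn hr)⟩

lemma core_iso [IsNoetherianRing R] (hE : IsInjectiveHullOfResidueField R E)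
    {T : Type u} [AddCommGroup T] [Module R T]
    (htor : IsAdicTorsion R (IsLocalRing.maximalIdeal R) T)
    (hx : ∃ x : T, x ≠ 0 ∧ ∀ a ∈ IsLocalRing.maximalIdeal R, a • x = 0)
    (hw : ∃ w : T, (∀ a ∈ IsLocalRing.maximalIdeal R, a • w = 0) ∧
      ∀ x : T, (∀ a ∈ IsLocalRing.maximalIdeal R, a • x = 0) → ∃ r : R, x = r • w)
    (hH : ∃ H : ModuleCat.{u} R, Nontrivial H ∧
      (∀ a ∈ IsLocalRing.maximalIdeal R, ∀ y : H, a • y = 0) ∧ XV R T H 1) :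
    Nonempty (T ≃ₗ[R] E) := by
  obtain ⟨hinj, f, hf, hess⟩ := hE
  obtain ⟨x, hx0, hx1⟩ := hx
  obtain ⟨w, hw0, hw1⟩ := hw
  obtain ⟨H, hHn, hHm, hHX⟩ := hH
  have hwne : w ≠ 0 := by
    rintro rfl
    obtain ⟨r, hr⟩ := hw1 x hx1
    exact hx0 (by simpa using hr)
  have hf1 : f 1 ≠ 0 := fun h => one_ne_zero (hf (h.trans (map_zero f).symm))
  have hf1m : ∀ a ∈ IsLocalRing.maximalIdeal R, a • f 1 = 0 := fun a ha =>
    range_killed f _ ⟨1, rfl⟩ a ha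
  -- the map
  let W := Submodule.span R {w}
  have hW : ∀ a ∈ IsLocalRing.maximalIdeal R, ∀ y : W, a • y = 0 := by
    rintro a ha ⟨y, hy⟩
    obtain ⟨r, rfl⟩ := Submodule.mem_span_singleton.1 hy
    apply Subtype.ext
    change a • r • w = 0
    rw [smul_comm, hw0 a ha, smul_zero]
  obtain ⟨φ, hφ⟩ := exists_map_socle hW ⟨w, Submodule.mem_span_singleton_self w⟩
    (fun h => hwne (congrArg Subtype.val h)) (f 1) hf1m
  obtain ⟨ψ, hψ⟩ := hinj.out W.subtype W.injective_subtype φ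
  have hψw : ψ w = f 1 := (hψ ⟨w, Submodule.mem_span_singleton_self w⟩).trans hφ
  have hinjψ : Function.Injective ψ := by
    rw [← LinearMap.ker_eq_bot, Submodule.eq_bot_iff]
    intro y hy
    by_contra hy0
    obtain ⟨r, hr, hr'⟩ := torsion_socle htor y hy0
    obtain ⟨s, hs⟩ := hw1 _ hr'
    rw [hs] at hr
    obtain ⟨t, ht⟩ := unit_smul_mem s w hw0 hr
    apply hf1
    rw [← hψw, ← ht, ← hs, map_smul, map_smul, LinearMap.mem_ker.1 hy, smul_zero, smul_zero]
  have hrange : LinearMap.range f ≤ LinearMap.range ψ := by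
    rintro _ ⟨k, rfl⟩
    obtain ⟨r, rfl⟩ := IsLocalRing.residue_surjective k
    refine ⟨r • w, ?_⟩
    rw [map_smul, hψw, ← map_smul, Algebra.smul_def, mul_one]; rfl
  have hsurj : Function.Surjective ψ := by
    rw [← LinearMap.range_eq_top]
    by_contra hne
    obtain ⟨e, he⟩ : ∃ e, e ∉ LinearMap.range ψ := by
      by_contra! hcon
      exact hne (eq_top_iff.2 fun e _ => hcon e)
    let Q := E ⧸ LinearMap.range ψ
    have hQ : IsAdicTorsion R (IsLocalRing.maximalIdeal R) Q := by
      intro q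
      obtain ⟨e, rfl⟩ := Submodule.Quotient.mk_surjective _ q
      obtain ⟨n, hn⟩ := hull_torsion f hess e
      exact ⟨n, fun r hr => by rw [← Submodule.Quotient.mk_smul, hn r hr]; rfl⟩
    obtain ⟨r, hr, hr'⟩ := torsion_socle hQ (Submodule.Quotient.mk e) (by
      rwa [Ne, Submodule.Quotient.mk_eq_zero])
    obtain ⟨y, hy⟩ := exists_ne (0 : H)
    obtain ⟨θ, hθ⟩ := exists_map_socle hHm y hy _ hr'
    obtain ⟨η, hη⟩ := XV.lift ψ (LinearMap.range ψ).mkQ hinjψ (by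
      rw [LinearMap.exact_iff, Submodule.ker_mkQ]) (Submodule.mkQ_surjective _) hHX θ
    apply hr
    rw [← hθ, hη, LinearMap.comp_apply, Submodule.mkQ_apply, Submodule.Quotient.mk_eq_zero]
    apply hrange
    apply socle_mem_range f hess
    intro a ha
    rw [← map_smul, hHm a ha, map_zero]
  exact ⟨LinearEquiv.ofBijective ψ ⟨hinjψ, hsurj⟩⟩
end Hull

/-- Let `(R, m, k)` be a local noetherian ring all of whose localizations are Gorenstein.
Then every `m`-adically semidualizing `R`-module `T` is isomorphic to the injective hull
`E_R(k)` of the residue field. -/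
theorem adicSemidualizing_iso_injectiveHull_of_gorenstein
    (R : Type u) [CommRing R] [IsLocalRing R] [IsNoetherianRing R]
    (hR : ∀ (p : Ideal R) (hp : p.IsPrime),
      letI := hp
      IsGorensteinLocalRing (Localization.AtPrime p))
    (E : Type u) [AddCommGroup E] [Module R E]
    (hE : IsInjectiveHullOfResidueField R E)
    (T : Type u) [AddCommGroup T] [Module R T]
    (hT : IsAdicSemidualizing R (IsLocalRing.maximalIdeal R) T) :
    Nonempty (T ≃ₗ[R] E) := by
  obtain ⟨htor, -, ⟨χ, hχ⟩, hext⟩ := hT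
  obtain ⟨d, D, hfree, hfin, δ, hG⟩ := exists_gdata' hR
  have hTD := exists_tdata T χ hχ hG
  have hTT : ∀ j, XV R T T (j+1) := fun j α => by
    have := ext_new (ModuleCat.of R T) j (hext (j+1) (by lia))
    exact Subsingleton.elim _ _
  obtain ⟨h1, h2, h3⟩ := hTD.top (fun i j => (hTT j).tensor (D i)) (torsion_socle htor)
  exact core_iso hE htor h1 h2 h3

end
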